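/- Recursion for the avalanche two-point function: in the stationary process of the DSS, for every x ∈ {2,…,L}, every t ≥ 1 and every τ ≥ 1, E[s(x,t) s(x,t+τ)] = E[s(x−1,t) s(x−1,t+τ)] − pq · P(s(x−1,t) ≥ 1, s(x−1,t+k) = 0 for all 1 ≤ k ≤ τ−1, and s(x−1,t+τ) ≥ 1). In particular E[s(x,t) s(x,t+τ)] ≤ E[s(x−1,t) s(x−1,t+τ)], so x ↦ E[s(x,t) s(x,t+τ)] is non-increasing. -/

import Mathlib

namespace DSS

/-- A state of the DSS on `L` sites: a stable field `z : Fin L → Bool` together with a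
finite multiset `w` of waiting particles (particles past site `L` have left the system). -/
structure State (L : ℕ) where
  z : Fin L → Bool
  w : Multiset (Fin L)

variable {L : ℕ}

/-- The multiset holding the right neighbour of `x`; empty if the particle leaves the system. -/
def succSite (L : ℕ) (x : Fin L) : Multiset (Fin L) :=
  if h : x.val + 1 < L then {(⟨x.val + 1, h⟩ : Fin L)} else 0

/-- Evolution of a waiting particle at `x` when `z x = 1`: the waiting particle moves to
`x+1` and the stable particle at `x` becomes a waiting particle at `x`. -/
def topple (s : State L) (x : Fin L) : State L :=
  ⟨Function.update s.z x false, s.w + succSite L x⟩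

/-- Evolution of a waiting particle at `x` when `z x = 0`, settling branch (probability p). -/
def settle (s : State L) (x : Fin L) : State L :=
  ⟨Function.update s.z x true, s.w.erase x⟩

/-- Evolution of a waiting particle at `x` when `z x = 0`, jumping branch (probability q). -/
def jump (s : State L) (x : Fin L) : State L :=
  ⟨s.z, s.w.erase x + succSite L x⟩

/-- `stabilizeAux p q R n s c` is the probability that, evolving one waiting particle at a
time (the particle being selected by the rule `R`), the process started from `s` reaches
within `n` elementary steps a stable state whose stable field is `c`. -/
noncomputable def stabilizeAux (p q : ℝ) (R : State L → Option (Fin L)) :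
    ℕ → State L → (Fin L → Bool) → ℝ
  | 0, s, c => if s.w = 0 ∧ s.z = c then 1 else 0
  | n + 1, s, c =>
    match R s with
    | none => if s.z = c then 1 else 0
    | some x =>
      if s.z x then stabilizeAux p q R n (topple s x) c
      else p * stabilizeAux p q R n (settle s x) c
        + q * stabilizeAux p q R n (jump s x) c

/-- The canonical evolution rule: evolve the leftmost waiting particle. -/
def minRule (s : State L) : Option (Fin L) :=
  if h : s.w = 0 then none
  else some (s.w.toFinset.min'
    (Finset.nonempty_iff_ne_empty.mpr (by simpa [Multiset.toFinset_eq_empty] using h)))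

/-- A termination measure: the stabilization process started from `s` ends after at most
`fuel s` elementary steps, whatever the rule and the randomness. -/
def potential (s : State L) : ℕ :=
  (s.w.map fun x => L + 1 - x.val).sum + ∑ x : Fin L, (if s.z x then L + 1 - x.val else 0)

def fuel (s : State L) : ℕ := 2 * potential s + Multiset.card s.w

/-- Add one waiting particle at site `1` (index `0`). -/
def addGrain (r : Fin L → Bool) : State L :=
  ⟨r, if h : 0 < L then {(⟨0, h⟩ : Fin L)} else 0⟩

/-- The driven-dissipative transition kernel `W` of the DSS: add a particle at site 1 and
stabilize. -/
noncomputable def Wker (p q : ℝ) (r r' : Fin L → Bool) : ℝ :=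
  stabilizeAux p q minRule (fuel (addGrain r)) (addGrain r) r'

/-- `W` as a matrix on stable configurations. -/
noncomputable def Wmat (p q : ℝ) (L : ℕ) :
    Matrix (Fin L → Bool) (Fin L → Bool) ℝ :=
  Matrix.of fun r r' => Wker p q r r'

/-- The product Bernoulli(p) measure `ψ(r) = p^(Σ r) q^(L - Σ r)`. -/
noncomputable def psi (p q : ℝ) {L : ℕ} (r : Fin L → Bool) : ℝ :=
  p ^ (Finset.univ.filter fun x => r x = true).card *
    q ^ (L - (Finset.univ.filter fun x => r x = true).card)



/-- Same as `stabilizeAux`, additionally recording the number of topplings performed at each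
site: `stabilizeSAux p q R n s c k` is the probability that the process started from `s`
terminates within `n` steps on the stable field `c` having performed exactly `k x`
topplings (transfers of a waiting particle from `x` to `x+1`) at each site `x`. -/
noncomputable def stabilizeSAux (p q : ℝ) (R : State L → Option (Fin L)) :
    ℕ → State L → (Fin L → Bool) → (Fin L → ℕ) → ℝ
  | 0, s, c, k => if s.w = 0 ∧ s.z = c ∧ k = 0 then 1 else 0
  | n + 1, s, c, k =>
    match R s with
    | none => if s.z = c ∧ k = 0 then 1 else 0
    | some x =>
      if s.z x then
        (if k x = 0 then 0
          else stabilizeSAux p q R n (topple s x) c (Function.update k x (k x - 1)))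
      else
        p * stabilizeSAux p q R n (settle s x) c k
          + q * (if k x = 0 then 0
              else stabilizeSAux p q R n (jump s x) c (Function.update k x (k x - 1)))

/-- Joint avalanche kernel: `Kker p q r r' k` is the probability that, adding one particle
at site 1 to the stable configuration `r`, the resulting avalanche leads to the stable
configuration `r'` with exactly `k x` topplings at each site `x`. -/
noncomputable def Kker (p q : ℝ) (r r' : Fin L → Bool) (k : Fin L → ℕ) : ℝ :=
  stabilizeSAux p q minRule (fuel (addGrain r)) (addGrain r) r' k

/-- `E[s(x,t)]`: expectation of the number of topplings at site `x` in the `t`-th avalanche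
(`t ≥ 1`), for the stationary process started from `ψ`. -/
noncomputable def meanS (p q : ℝ) (L : ℕ) (t : ℕ) (x : Fin L) : ℝ :=
  ∑ r0 : Fin L → Bool, ∑ r1 : Fin L → Bool, ∑ r2 : Fin L → Bool,
    ∑' k : Fin L → ℕ,
      psi p q r0 * ((Wmat p q L) ^ (t - 1)) r0 r1 * Kker p q r1 r2 k * (k x : ℝ)

/-- `E[s(x,t) s(x',t+τ)]` (`t, τ ≥ 1`) for the stationary process started from `ψ`. -/
noncomputable def corrS (p q : ℝ) (L : ℕ) (t τ : ℕ) (x x' : Fin L) : ℝ :=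
  ∑ r0 : Fin L → Bool, ∑ r1 : Fin L → Bool, ∑ r2 : Fin L → Bool,
    ∑ r3 : Fin L → Bool, ∑ r4 : Fin L → Bool,
      ∑' k1 : Fin L → ℕ, ∑' k2 : Fin L → ℕ,
        psi p q r0 * ((Wmat p q L) ^ (t - 1)) r0 r1 *
          Kker p q r1 r2 k1 * (k1 x : ℝ) *
          ((Wmat p q L) ^ (τ - 1)) r2 r3 *
          Kker p q r3 r4 k2 * (k2 x' : ℝ)


/-- Restriction of the avalanche kernel to avalanches making no toppling at site `j`. -/
noncomputable def W0ker (p q : ℝ) {L : ℕ} (j : Fin L) (r r' : Fin L → Bool) : ℝ :=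
  ∑' k : Fin L → ℕ, if k j = 0 then Kker p q r r' k else 0

/-- The sub-stochastic matrix `W_j^0` of transitions whose avalanche makes no toppling
at site `j`. -/
noncomputable def W0mat (p q : ℝ) (L : ℕ) (j : Fin L) :
    Matrix (Fin L → Bool) (Fin L → Bool) ℝ :=
  Matrix.of fun r r' => W0ker p q j r r'

/-- The probability `P(s(j,t) ≥ 1, s(j,t+k) = 0 for all 1 ≤ k ≤ τ-1, s(j,t+τ) ≥ 1)`
in the stationary process. -/
noncomputable def avalGapProb (p q : ℝ) (L : ℕ) (t τ : ℕ) (j : Fin L) : ℝ :=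
  ∑ r0 : Fin L → Bool, ∑ r1 : Fin L → Bool, ∑ r2 : Fin L → Bool,
    ∑ r3 : Fin L → Bool, ∑ r4 : Fin L → Bool,
      ∑' k1 : Fin L → ℕ, ∑' k2 : Fin L → ℕ,
        psi p q r0 * ((Wmat p q L) ^ (t - 1)) r0 r1 *
          (if 1 ≤ k1 j then Kker p q r1 r2 k1 else 0) *
          ((W0mat p q L j) ^ (τ - 1)) r2 r3 *
          (if 1 ≤ k2 j then Kker p q r3 r4 k2 else 0)

/-- Probability that a site with stable occupation `b` that receives `a` waiting particles
in total ends with stable occupation `c`. -/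
noncomputable def siteWeight (p q : ℝ) (a : ℕ) (b c : Bool) : ℝ :=
  if a = 0 then (if b = c then 1 else 0) else (if c then p else q)

/-- The number of particles crossing from site `i - 1` to site `i` (as indices) when the state `s`
stabilizes to the stable field `c`. -/
def outflow (s : State L) (c : Fin L → Bool) : ℕ → ℕ
  | 0 => 0
  | i + 1 => if h : i < L then
      s.w.count ⟨i, h⟩ + outflow s c i + (s.z ⟨i, h⟩).toNat - (c ⟨i, h⟩).toNat else 0

/-- The total number of waiting particles received by the site `y` when the state `s`
stabilizes to the stable field `c`. -/
def inflow (s : State L) (c : Fin L → Bool) (y : Fin L) : ℕ :=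
  s.w.count y + outflow s c y

/-- Probability that the state `s` stabilizes to the stable field `c`. -/
noncomputable def weight (p q : ℝ) (s : State L) (c : Fin L → Bool) : ℝ :=
  ∏ y, siteWeight p q (inflow s c y) (s.z y) (c y)

lemma outflow_succ (s : State L) (c : Fin L → Bool) (y : Fin L) :
    outflow s c (y + 1) = inflow s c y + (s.z y).toNat - (c y).toNat := by
  simp [outflow, inflow]

lemma outflow_congr {s s' : State L} {c c' : Fin L → Bool} (i : ℕ)
    (hw : ∀ y : Fin L, (y : ℕ) < i → s'.w.count y = s.w.count y)
    (hz : ∀ y : Fin L, (y : ℕ) < i → s'.z y = s.z y)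
    (hc : ∀ y : Fin L, (y : ℕ) < i → c' y = c y) :
    outflow s' c' i = outflow s c i := by
  induction i with
  | zero => rfl
  | succ i ih =>
    have hi := ih (fun y hy => hw y (by omega)) (fun y hy => hz y (by omega))
      (fun y hy => hc y (by omega))
    by_cases h : i < L
    · simp only [outflow, h, dite_true]
      rw [hi, hw ⟨i, h⟩ (by simp), hz ⟨i, h⟩ (by simp), hc ⟨i, h⟩ (by simp)]
    · simp [outflow, h]

/-- A local move at `x` that sends `d` particles to `x + 1` lowers the remaining flow out of `x`
by `d` and leaves every other flow unchanged. -/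
lemma outflow_move {s s' : State L} {c : Fin L → Bool} {x : Fin L} {d : ℕ}
    (hz : ∀ y, y ≠ x → s'.z y = s.z y)
    (hw : ∀ y, y ≠ x → s'.w.count y = s.w.count y + if (y : ℕ) = x + 1 then d else 0)
    (hx : s'.w.count x + (s'.z x).toNat + d = s.w.count x + (s.z x).toNat)
    (hd : (c x).toNat + d ≤ inflow s c x + (s.z x).toNat) (i : ℕ) :
    outflow s' c i + (if i = x + 1 then d else 0) = outflow s c i := by
  induction i with
  | zero => simp [outflow]
  | succ i ih =>
    by_cases h : i < L
    · simp only [outflow, h, dite_true]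
      by_cases hix : (⟨i, h⟩ : Fin L) = x
      · subst hix
        simp only [inflow] at hd
        simp at ih ⊢
        omega
      · have hne : i ≠ x := fun e => hix (Fin.ext e)
        rw [hz _ hix, hw _ hix]
        simp only [Nat.add_right_cancel_iff, hne, if_false]
        split_ifs at ih ⊢ <;> omega
    · have := x.2
      rw [if_neg (by omega)]
      simp [outflow, h]

lemma inflow_move {s s' : State L} {c : Fin L → Bool} {x : Fin L} {d : ℕ}
    (hz : ∀ y, y ≠ x → s'.z y = s.z y)
    (hw : ∀ y, y ≠ x → s'.w.count y = s.w.count y + if (y : ℕ) = x + 1 then d else 0)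
    (hx : s'.w.count x + (s'.z x).toNat + d = s.w.count x + (s.z x).toNat)
    (hd : (c x).toNat + d ≤ inflow s c x + (s.z x).toNat) (y : Fin L) (hy : y ≠ x) :
    inflow s' c y = inflow s c y := by
  have := outflow_move hz hw hx hd y
  have := hw y hy
  simp only [inflow]
  omega

lemma weight_move (p q : ℝ) {s s' : State L} {c : Fin L → Bool} {x : Fin L} {d : ℕ}
    (hz : ∀ y, y ≠ x → s'.z y = s.z y)
    (hw : ∀ y, y ≠ x → s'.w.count y = s.w.count y + if (y : ℕ) = x + 1 then d else 0)
    (hx : s'.w.count x + (s'.z x).toNat + d = s.w.count x + (s.z x).toNat)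
    (hd : (c x).toNat + d ≤ inflow s c x + (s.z x).toNat) :
    weight p q s' c = siteWeight p q (inflow s' c x) (s'.z x) (c x) *
      ∏ y ∈ Finset.univ.erase x, siteWeight p q (inflow s c y) (s.z y) (c y) := by
  rw [weight, ← Finset.mul_prod_erase _ _ (Finset.mem_univ x)]
  congr 1
  refine Finset.prod_congr rfl fun y hy => ?_
  have hy := Finset.ne_of_mem_erase hy
  rw [inflow_move hz hw hx hd y hy, hz y hy]

lemma weight_eq_mul (p q : ℝ) (s : State L) (c : Fin L → Bool) (x : Fin L) :
    weight p q s c = siteWeight p q (inflow s c x) (s.z x) (c x) *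
      ∏ y ∈ Finset.univ.erase x, siteWeight p q (inflow s c y) (s.z y) (c y) :=
  (Finset.mul_prod_erase _ _ (Finset.mem_univ x)).symm

lemma outflow_of_empty {s : State L} {c : Fin L → Bool} (hs : s.w = 0) (i : ℕ)
    (h : ∀ y : Fin L, (y : ℕ) < i → s.z y = c y) : outflow s c i = 0 := by
  induction i with
  | zero => rfl
  | succ i ih =>
    have hi := ih fun y hy => h y (by omega)
    by_cases hL : i < L
    · simp [outflow, hL, hs, hi, h ⟨i, hL⟩ (by simp)]
    · simp [outflow, hL]

lemma weight_of_empty (p q : ℝ) {s : State L} (c : Fin L → Bool) (hs : s.w = 0) :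
    weight p q s c = if s.z = c then 1 else 0 := by
  split_ifs with h
  · refine Finset.prod_eq_one fun y _ => ?_
    simp [siteWeight, inflow, hs, outflow_of_empty hs y fun y _ => congrFun h y, h]
  · by_contra hne
    have hy := Finset.prod_ne_zero_iff.mp hne
    have key : ∀ i : ℕ, ∀ y : Fin L, (y : ℕ) < i → s.z y = c y := by
      intro i
      induction i with
      | zero => intro y hy; omega
      | succ i ih =>
        intro y hyi
        by_contra hc
        refine hy y (Finset.mem_univ y) ?_
        simp [siteWeight, inflow, hs, hc,
          outflow_of_empty hs y fun y' hy' => ih y' (by omega)]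
    exact h (funext fun y => key L y y.2)

lemma count_succSite (x y : Fin L) :
    (succSite L x).count y = if (y : ℕ) = x + 1 then 1 else 0 := by
  unfold succSite
  have := y.2
  split_ifs with h1 h2 h2
  · rw [Multiset.count_singleton, if_pos (Fin.ext h2)]
  · rw [Multiset.count_singleton, if_neg (fun e => h2 (congrArg Fin.val e))]
  · omega
  · simp

lemma topple_z (s : State L) (x y : Fin L) (hy : y ≠ x) : (topple s x).z y = s.z y := by
  simp [topple, hy]

lemma topple_w (s : State L) (x y : Fin L) :
    (topple s x).w.count y = s.w.count y + if (y : ℕ) = x + 1 then 1 else 0 := by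
  simp [topple, count_succSite]

lemma settle_z (s : State L) (x y : Fin L) (hy : y ≠ x) : (settle s x).z y = s.z y := by
  simp [settle, hy]

lemma settle_z_self (s : State L) (x : Fin L) : (settle s x).z x = true := by
  simp [settle]

lemma settle_w (s : State L) (x y : Fin L) (hy : y ≠ x) :
    (settle s x).w.count y = s.w.count y + if (y : ℕ) = x + 1 then 0 else 0 := by
  simp [settle, Multiset.count_erase_of_ne hy]

lemma jump_w (s : State L) (x y : Fin L) (hy : y ≠ x) :
    (jump s x).w.count y = s.w.count y + if (y : ℕ) = x + 1 then 1 else 0 := by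
  simp [jump, count_succSite, Multiset.count_erase_of_ne hy]

lemma topple_at {s : State L} {x : Fin L} (hz : s.z x = true) :
    (topple s x).w.count x + ((topple s x).z x).toNat + 1 = s.w.count x + (s.z x).toNat := by
  rw [topple_w, hz]
  simp [topple]

lemma settle_at {s : State L} {x : Fin L} (hx : x ∈ s.w) (hz : s.z x = false) :
    (settle s x).w.count x + ((settle s x).z x).toNat + 0 = s.w.count x + (s.z x).toNat := by
  have := Multiset.count_pos.mpr hx
  simp [settle, hz]
  omega

lemma jump_at {s : State L} {x : Fin L} (hx : x ∈ s.w) :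
    (jump s x).w.count x + ((jump s x).z x).toNat + 1 = s.w.count x + (s.z x).toNat := by
  have := Multiset.count_pos.mpr hx
  simp [jump, count_succSite]
  omega

lemma one_le_inflow {s : State L} {x : Fin L} (hx : x ∈ s.w) (c : Fin L → Bool) :
    1 ≤ inflow s c x :=
  (Multiset.count_pos.mpr hx).trans_le (Nat.le_add_right _ _)

lemma topple_bound {s : State L} {x : Fin L} (hx : x ∈ s.w) (hz : s.z x = true)
    (c : Fin L → Bool) : (c x).toNat + 1 ≤ inflow s c x + (s.z x).toNat := by
  have := one_le_inflow hx c
  have := (c x).toNat_le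
  simp [hz]
  omega

lemma settle_bound {s : State L} {x : Fin L} (hx : x ∈ s.w)
    (c : Fin L → Bool) : (c x).toNat + 0 ≤ inflow s c x + (s.z x).toNat := by
  have := one_le_inflow hx c
  have := (c x).toNat_le
  omega

lemma outflow_topple {s : State L} {x : Fin L} (hx : x ∈ s.w) (hz : s.z x = true)
    (c : Fin L → Bool) (i : ℕ) :
    outflow (topple s x) c i + (if i = x + 1 then 1 else 0) = outflow s c i :=
  outflow_move (topple_z s x) (fun y _ => topple_w s x y) (topple_at hz) (topple_bound hx hz c) i

lemma outflow_settle {s : State L} {x : Fin L} (hx : x ∈ s.w) (hz : s.z x = false)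
    (c : Fin L → Bool) (i : ℕ) : outflow (settle s x) c i = outflow s c i := by
  simpa using outflow_move (settle_z s x) (settle_w s x) (settle_at hx hz) (settle_bound hx c) i

lemma outflow_jump {s : State L} {x : Fin L} (hx : x ∈ s.w) {c : Fin L → Bool}
    (hc : (c x).toNat + 1 ≤ inflow s c x + (s.z x).toNat) (i : ℕ) :
    outflow (jump s x) c i + (if i = x + 1 then 1 else 0) = outflow s c i :=
  outflow_move (s := s) (s' := jump s x) (fun _ _ => rfl) (jump_w s x) (jump_at hx) hc i

lemma outflow_move_self {s s' : State L} {c : Fin L → Bool} {x : Fin L} {d : ℕ}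
    (hz : ∀ y, y ≠ x → s'.z y = s.z y)
    (hw : ∀ y, y ≠ x → s'.w.count y = s.w.count y + if (y : ℕ) = x + 1 then d else 0) :
    outflow s' c x = outflow s c x := by
  refine outflow_congr _ (fun y hy => ?_) (fun y hy => hz y (Fin.ne_of_lt hy)) fun _ _ => rfl
  rw [hw y (Fin.ne_of_lt hy), if_neg (by omega), add_zero]

lemma weight_topple (p q : ℝ) {s : State L} {x : Fin L} (hx : x ∈ s.w) (hz : s.z x = true)
    (c : Fin L → Bool) : weight p q (topple s x) c = weight p q s c := by
  rw [weight_move p q (topple_z s x) (fun y _ => topple_w s x y) (topple_at hz)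
    (topple_bound hx hz c), weight_eq_mul p q s c x]
  have h1 := one_le_inflow hx c
  have h2 : inflow (topple s x) c x = inflow s c x := by
    have := outflow_topple hx hz c x
    rw [if_neg (by omega)] at this
    have hw := topple_w s x x
    rw [if_neg (by omega)] at hw
    simp only [inflow]
    omega
  rw [h2]
  simp [siteWeight, show inflow s c x ≠ 0 by omega]

lemma inflow_settle {s : State L} {x : Fin L} (hx : x ∈ s.w) (c : Fin L → Bool) :
    inflow (settle s x) c x + 1 = inflow s c x := by
  have := Multiset.count_pos.mpr hx
  simp only [inflow, outflow_move_self (settle_z s x) (settle_w s x)]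
  simp [settle]
  omega

lemma inflow_jump {s : State L} {x : Fin L} (hx : x ∈ s.w) (c : Fin L → Bool) :
    inflow (jump s x) c x + 1 = inflow s c x := by
  have := Multiset.count_pos.mpr hx
  simp only [inflow, outflow_move_self (s := s) (s' := jump s x) (x := x)
    (fun _ _ => rfl) (jump_w s x)]
  simp [jump, count_succSite]
  omega

lemma weight_jump_eq_zero (p q : ℝ) {s : State L} {x : Fin L} (hx : x ∈ s.w)
    (hz : s.z x = false) {c : Fin L → Bool} (hc : inflow s c x < (c x).toNat + 1) :
    weight p q (jump s x) c = 0 := by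
  have h1 := inflow_jump hx c
  have h2 := (c x).toNat_le
  refine Finset.prod_eq_zero (Finset.mem_univ x) ?_
  have h3 : inflow (jump s x) c x = 0 := by omega
  have h4 : c x = true := by
    cases h : c x
    · simp [h] at hc; omega
    · rfl
  rw [h3, h4, show (jump s x).z x = false from hz]
  simp [siteWeight]

lemma weight_settle_jump {p q : ℝ} (hpq : p + q = 1) {s : State L} {x : Fin L} (hx : x ∈ s.w)
    (hz : s.z x = false) (c : Fin L → Bool) :
    p * weight p q (settle s x) c + q * weight p q (jump s x) c = weight p q s c := by
  have h1 := inflow_jump hx c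
  have h2 := inflow_settle hx c
  rw [weight_move p q (settle_z s x) (settle_w s x) (settle_at hx hz) (settle_bound hx c),
    weight_eq_mul p q s c x]
  by_cases hc : inflow s c x < (c x).toNat + 1
  · rw [weight_jump_eq_zero p q hx hz hc]
    have h3 : inflow s c x = 1 := by have := (c x).toNat_le; omega
    have h4 : c x = true := by
      cases h : c x
      · simp [h] at hc; omega
      · rfl
    have h5 : inflow (settle s x) c x = 0 := by omega
    rw [h3, h4, h5, settle_z_self]
    simp [siteWeight]
  · rw [weight_move p q (s := s) (s' := jump s x) (fun _ _ => rfl) (jump_w s x) (jump_at hx)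
      (by omega : (c x).toNat + 1 ≤ inflow s c x + (s.z x).toNat)]
    rw [← mul_assoc, ← mul_assoc, ← add_mul]
    congr 1
    by_cases h3 : inflow s c x = 1
    · have h4 : c x = false := by
        cases h : c x
        · rfl
        · simp [h] at hc; omega
      have h5 : inflow (settle s x) c x = 0 := by omega
      have h6 : inflow (jump s x) c x = 0 := by omega
      rw [h3, h4, h5, h6, settle_z_self, show (jump s x).z x = false from hz]
      simp [siteWeight]
    · simp only [siteWeight, show inflow (settle s x) c x ≠ 0 by omega,
        show inflow (jump s x) c x ≠ 0 by omega, show inflow s c x ≠ 0 by omega, if_false]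
      rw [← add_mul, hpq, one_mul]

lemma mem_of_minRule {s : State L} {x : Fin L} (h : minRule s = some x) : x ∈ s.w := by
  unfold minRule at h
  split_ifs at h with h0
  rw [← Option.some.inj h]
  exact Multiset.mem_toFinset.mp (Finset.min'_mem _ _)

lemma empty_of_minRule {s : State L} (h : minRule s = none) : s.w = 0 := by
  unfold minRule at h
  split_ifs at h with h0
  exact h0

lemma sum_map_succSite_le (x : Fin L) :
    ((succSite L x).map fun y : Fin L => L + 1 - (y : ℕ)).sum + 1 ≤ L + 1 - x := by
  have := x.2
  unfold succSite
  split_ifs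
  · simp; omega
  · simp; omega

lemma card_succSite_le (x : Fin L) : Multiset.card (succSite L x) ≤ 1 := by
  unfold succSite
  split_ifs <;> simp

lemma sum_update_potential (z : Fin L → Bool) (x : Fin L) (b : Bool) :
    (∑ y : Fin L, if Function.update z x b y then L + 1 - (y : ℕ) else 0) +
        (if z x then L + 1 - (x : ℕ) else 0) =
      (∑ y : Fin L, if z y then L + 1 - (y : ℕ) else 0) + if b then L + 1 - (x : ℕ) else 0 := by
  rw [← Finset.add_sum_erase _ _ (Finset.mem_univ x),
    ← Finset.add_sum_erase (a := x) _ (fun y : Fin L => if z y then L + 1 - (y : ℕ) else 0)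
      (Finset.mem_univ x)]
  have : ∀ y ∈ Finset.univ.erase x, (if Function.update z x b y then L + 1 - (y : ℕ) else 0) =
      if z y then L + 1 - (y : ℕ) else 0 := fun y hy => by
    rw [Function.update_of_ne (Finset.ne_of_mem_erase hy)]
  rw [Finset.sum_congr rfl this, Function.update_self]
  omega

lemma fuel_mk (z : Fin L → Bool) (w : Multiset (Fin L)) :
    fuel ⟨z, w⟩ = 2 * ((w.map fun y : Fin L => L + 1 - (y : ℕ)).sum +
      ∑ y : Fin L, if z y then L + 1 - (y : ℕ) else 0) + Multiset.card w := rfl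

lemma fuel_topple {s : State L} {x : Fin L} (hz : s.z x = true) :
    fuel (topple s x) < fuel s := by
  have h1 := sum_map_succSite_le x
  have h2 := card_succSite_le x
  have h3 := sum_update_potential s.z x false
  simp only [hz, if_true, Bool.false_eq_true, if_false] at h3
  rw [topple, fuel_mk, fuel_mk s.z s.w]
  simp only [Multiset.map_add, Multiset.sum_add, Multiset.card_add]
  omega

lemma sum_map_erase {s : State L} {x : Fin L} (hx : x ∈ s.w) :
    L + 1 - x + ((s.w.erase x).map fun y : Fin L => L + 1 - (y : ℕ)).sum =
      (s.w.map fun y : Fin L => L + 1 - (y : ℕ)).sum := by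
  conv_rhs => rw [← Multiset.cons_erase hx]
  simp

lemma fuel_settle {s : State L} {x : Fin L} (hx : x ∈ s.w) (hz : s.z x = false) :
    fuel (settle s x) < fuel s := by
  have h1 := sum_map_erase hx
  have h2 := Multiset.card_erase_add_one hx
  have h3 := sum_update_potential s.z x true
  simp only [hz, if_true, Bool.false_eq_true, if_false] at h3
  rw [settle, fuel_mk, fuel_mk s.z s.w]
  omega

lemma fuel_jump {s : State L} {x : Fin L} (hx : x ∈ s.w) :
    fuel (jump s x) < fuel s := by
  have h1 := sum_map_erase hx
  have h2 := Multiset.card_erase_add_one hx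
  have h3 := sum_map_succSite_le x
  have h4 := card_succSite_le x
  rw [jump, fuel_mk, fuel_mk s.z s.w]
  simp only [Multiset.map_add, Multiset.sum_add, Multiset.card_add]
  omega

lemma stabilizeAux_eq_weight {p q : ℝ} (hpq : p + q = 1) (n : ℕ) (s : State L)
    (c : Fin L → Bool) (hn : fuel s ≤ n) :
    stabilizeAux p q minRule n s c = weight p q s c := by
  induction n generalizing s with
  | zero =>
    have hw : s.w = 0 := Multiset.card_eq_zero.mp (by unfold fuel at hn; omega)
    simp [stabilizeAux, weight_of_empty p q c hw, hw]
  | succ n ih =>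
    rw [stabilizeAux]
    split
    · next h => rw [weight_of_empty p q c (empty_of_minRule h)]
    · next x h =>
      have hx := mem_of_minRule h
      split_ifs with hz
      · have := fuel_topple hz
        rw [ih _ (by omega), weight_topple p q hx hz]
      · have hz : s.z x = false := by simpa using hz
        have := fuel_settle hx hz
        have := fuel_jump hx
        rw [ih _ (by omega), ih _ (by omega), weight_settle_jump hpq hx hz]

/-- A toppling at `x` shifts the toppling record by one at `x`. -/
lemma record_shift_iff {s s' : State L} {c : Fin L → Bool} {x : Fin L} {k : Fin L → ℕ}
    (h : ∀ i : ℕ, outflow s' c i + (if i = x + 1 then 1 else 0) = outflow s c i)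
    (hk : k x ≠ 0) :
    (∀ y : Fin L, Function.update k x (k x - 1) y = outflow s' c (y + 1)) ↔
      ∀ y : Fin L, k y = outflow s c (y + 1) := by
  refine forall_congr' fun y => ?_
  have hy := h (y + 1)
  by_cases hyx : y = x
  · subst hyx
    rw [if_pos rfl] at hy
    rw [Function.update_self]
    omega
  · rw [if_neg (by omega)] at hy
    rw [Function.update_of_ne hyx]
    omega

lemma outflow_ne_zero_of_shift {s s' : State L} {c : Fin L → Bool} {x : Fin L} {k : Fin L → ℕ}
    (h : ∀ i : ℕ, outflow s' c i + (if i = x + 1 then 1 else 0) = outflow s c i)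
    (hk : k x = 0) : ¬ ∀ y : Fin L, k y = outflow s c (y + 1) := by
  intro hy
  have h1 := h (x + 1)
  have h2 := hy x
  rw [if_pos rfl] at h1
  omega

lemma record_of_empty (p q : ℝ) {s : State L} (c : Fin L → Bool) (k : Fin L → ℕ) (hw : s.w = 0) :
    (if s.z = c ∧ k = 0 then (1 : ℝ) else 0) =
      if ∀ y : Fin L, k y = outflow s c (y + 1) then weight p q s c else 0 := by
  rw [weight_of_empty p q c hw]
  by_cases hz : s.z = c
  · have : (∀ y : Fin L, k y = outflow s c (y + 1)) ↔ k = 0 := by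
      simp only [outflow_of_empty hw _ fun y _ => congrFun hz y, funext_iff, Pi.zero_apply]
    simp [hz, this]
  · simp [hz]

lemma stabilizeSAux_eq_weight {p q : ℝ} (hpq : p + q = 1) (n : ℕ) (s : State L)
    (c : Fin L → Bool) (k : Fin L → ℕ) (hn : fuel s ≤ n) :
    stabilizeSAux p q minRule n s c k =
      if ∀ y : Fin L, k y = outflow s c (y + 1) then weight p q s c else 0 := by
  induction n generalizing s k with
  | zero =>
    have hw : s.w = 0 := Multiset.card_eq_zero.mp (by unfold fuel at hn; omega)
    rw [← record_of_empty p q c k hw]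
    simp [stabilizeSAux, hw]
  | succ n ih =>
    rw [stabilizeSAux]
    split
    · next h => exact record_of_empty p q c k (empty_of_minRule h)
    · next x h =>
      have hx := mem_of_minRule h
      by_cases hz : s.z x = true
      · have := fuel_topple hz
        have ho := outflow_topple hx hz c
        rw [if_pos hz]
        by_cases hk : k x = 0
        · rw [if_pos hk, if_neg (outflow_ne_zero_of_shift ho hk)]
        · rw [if_neg hk, ih _ _ (by omega), weight_topple p q hx hz]
          simp only [record_shift_iff ho hk]
      · rw [if_neg hz]
        have hz : s.z x = false := by simpa using hz
        have := fuel_settle hx hz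
        have := fuel_jump hx
        rw [ih (settle s x) _ (by omega), ih (jump s x) _ (by omega),
          ← weight_settle_jump hpq hx hz]
        simp only [outflow_settle hx hz]
        by_cases hc : inflow s c x < (c x).toNat + 1
        · simp [weight_jump_eq_zero p q hx hz hc]
        · have ho := outflow_jump hx (c := c) (by omega)
          by_cases hk : k x = 0
          · simp [if_neg (outflow_ne_zero_of_shift ho hk), hk]
          · rw [if_neg hk]
            simp only [record_shift_iff ho hk]
            split_ifs <;> simp

/-- The number of topplings at `y` in the avalanche leading from `r` to `r'`. -/
def flux (r r' : Fin L → Bool) (y : Fin L) : ℕ := outflow (addGrain r) r' (y + 1)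

/-- The number of waiting particles received by `y` in the avalanche leading from `r` to `r'`. -/
def arrivals (r r' : Fin L → Bool) (y : Fin L) : ℕ := inflow (addGrain r) r' y

/-- The sites to the left of position `m`. -/
def below (L m : ℕ) : Set (Fin L) := {y | (y : ℕ) < m}

/-- The transition weight in which the sites from position `m` on are made uniform. -/
noncomputable def partialWeight (p q : ℝ) (m : ℕ) (r r' : Fin L → Bool) : ℝ :=
  ∏ y : Fin L, if (y : ℕ) < m then siteWeight p q (arrivals r r' y) (r y) (r' y) else 1 / 2

lemma Wker_eq {p q : ℝ} (hpq : p + q = 1) (r r' : Fin L → Bool) :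
    Wker p q r r' = weight p q (addGrain r) r' :=
  stabilizeAux_eq_weight hpq _ _ _ le_rfl

lemma Kker_eq {p q : ℝ} (hpq : p + q = 1) (r r' : Fin L → Bool) (k : Fin L → ℕ) :
    Kker p q r r' k = if k = flux r r' then Wker p q r r' else 0 := by
  rw [Kker, stabilizeSAux_eq_weight hpq _ _ _ _ le_rfl, Wker_eq hpq]
  simp only [funext_iff, flux]

lemma partialWeight_top {p q : ℝ} (hpq : p + q = 1) (r r' : Fin L → Bool) :
    partialWeight p q L r r' = Wker p q r r' := by
  rw [Wker_eq hpq]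
  simp [partialWeight, weight, arrivals, addGrain]

lemma arrivals_congr {r₁ r₂ r₁' r₂' : Fin L → Bool} (x : Fin L)
    (h : ∀ y ∈ below L x, r₁ y = r₂ y) (h' : ∀ y ∈ below L x, r₁' y = r₂' y) :
    arrivals r₁ r₁' x = arrivals r₂ r₂' x := by
  simp only [arrivals, inflow]
  congr 1
  exact outflow_congr _ (fun _ _ => rfl) (fun y hy => h y hy) (fun y hy => h' y hy)

lemma partialWeight_congr (p q : ℝ) {m : ℕ} {r₁ r₂ r₁' r₂' : Fin L → Bool}
    (h : ∀ y ∈ below L m, r₁ y = r₂ y) (h' : ∀ y ∈ below L m, r₁' y = r₂' y) :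
    partialWeight p q m r₁ r₁' = partialWeight p q m r₂ r₂' := by
  refine Finset.prod_congr rfl fun y _ => ?_
  split_ifs with hy
  · rw [h y hy, h' y hy, arrivals_congr y (fun i hi => h i (lt_trans hi hy))
      (fun i hi => h' i (lt_trans hi hy))]
  · rfl

lemma update_eq_below (r : Fin L → Bool) (x : Fin L) (b : Bool) :
    ∀ y ∈ below L x, Function.update r x b y = r y :=
  fun _ hy => Function.update_of_ne (Fin.ne_of_lt hy) _ _

lemma below_mono {m n : ℕ} (h : m ≤ n) : below L m ⊆ below L n :=
  fun _ hy => lt_of_lt_of_le hy h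

lemma update_agree {r₁ r₂ : Fin L → Bool} {x : Fin L} (h : ∀ y ∈ below L x, r₁ y = r₂ y)
    (b : Bool) : ∀ y ∈ below L (x + 1), Function.update r₁ x b y = Function.update r₂ x b y := by
  intro y hy
  by_cases hyx : y = x
  · subst hyx; simp
  · rw [Function.update_of_ne hyx, Function.update_of_ne hyx]
    have : (y : ℕ) < x + 1 := hy
    exact h y (show (y : ℕ) < x by omega)

lemma partialWeight_succ_update (p q : ℝ) (r r' : Fin L → Bool) (x : Fin L) (b : Bool) :
    partialWeight p q (x + 1) r (Function.update r' x b) =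
      2 * siteWeight p q (arrivals r r' x) (r x) b * partialWeight p q x r r' := by
  rw [← partialWeight_congr p q (fun _ _ => rfl) (update_eq_below r' x b), partialWeight,
    partialWeight, ← Finset.mul_prod_erase _ _ (Finset.mem_univ x),
    ← Finset.mul_prod_erase (a := x) _ (fun y : Fin L => if (y : ℕ) < x then _ else _)
      (Finset.mem_univ x),
    if_pos (Nat.lt_succ_self _), if_neg (lt_irrefl _), Function.update_self,
    arrivals_congr x (fun _ _ => rfl) (update_eq_below r' x b)]
  have : ∀ y ∈ Finset.univ.erase x, ((y : ℕ) < x + 1 ↔ (y : ℕ) < x) := fun y hy => by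
    have := Fin.val_ne_of_ne (Finset.ne_of_mem_erase hy)
    omega
  rw [Finset.prod_congr rfl fun y hy => by rw [if_congr (this y hy) rfl rfl]]
  ring

lemma sum_update_bool (x : Fin L) (f : (Fin L → Bool) → ℝ) :
    ∑ r, (f (Function.update r x true) + f (Function.update r x false)) = 2 * ∑ r, f r := by
  have hinv : Function.Involutive fun r : Fin L → Bool => Function.update r x (!r x) := by
    intro r
    simp
  have h : ∀ r : Fin L → Bool, f (Function.update r x true) + f (Function.update r x false) =
      f r + f (Function.update r x (!r x)) := by
    intro r
    cases hr : r x
    · rw [add_comm]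
      conv_rhs => rw [← Function.update_eq_self x r]
      simp [hr]
    · conv_rhs => rw [← Function.update_eq_self x r]
      simp [hr]
  rw [Finset.sum_congr rfl fun r _ => h r, Finset.sum_add_distrib, two_mul]
  congr 1
  exact Equiv.sum_comp hinv.toPerm f

/-- The average of `φ` over the new value of the site `x`, given the rest of the avalanche. -/
noncomputable def resample (p q : ℝ) (x : Fin L) (b : Bool) (φ : (Fin L → Bool) → ℝ)
    (r r' : Fin L → Bool) : ℝ :=
  siteWeight p q (arrivals r r' x) b true * φ (Function.update r' x true) +
    siteWeight p q (arrivals r r' x) b false * φ (Function.update r' x false)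

lemma resample_of_eq_zero (p q : ℝ) {x : Fin L} (b : Bool) (φ : (Fin L → Bool) → ℝ)
    {r r' : Fin L → Bool} (h : arrivals r r' x = 0) :
    resample p q x b φ r r' = φ (Function.update r' x b) := by
  cases b <;> simp [resample, siteWeight, h]

lemma resample_of_ne_zero (p q : ℝ) {x : Fin L} (b : Bool) (φ : (Fin L → Bool) → ℝ)
    {r r' : Fin L → Bool} (h : arrivals r r' x ≠ 0) :
    resample p q x b φ r r' =
      p * φ (Function.update r' x true) + q * φ (Function.update r' x false) := by
  simp [resample, siteWeight, h]

lemma sum_partialWeight_succ (p q : ℝ) (x : Fin L) (r : Fin L → Bool)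
    (φ : (Fin L → Bool) → ℝ) :
    ∑ r', partialWeight p q (x + 1) r r' * φ r' =
      ∑ r', partialWeight p q x r r' * resample p q x (r x) φ r r' := by
  have h := sum_update_bool x fun r' => partialWeight p q (x + 1) r r' * φ r'
  simp only [partialWeight_succ_update] at h
  refine mul_left_cancel₀ (two_ne_zero (α := ℝ)) ?_
  rw [← h, Finset.mul_sum]
  refine Finset.sum_congr rfl fun r' _ => ?_
  rw [resample]
  ring

lemma siteWeight_sum {p q : ℝ} (hpq : p + q = 1) (a : ℕ) (b : Bool) :
    siteWeight p q a b true + siteWeight p q a b false = 1 := by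
  unfold siteWeight
  split_ifs <;> cases b <;> simp_all

lemma resample_of_dependsOn {p q : ℝ} (hpq : p + q = 1) (x : Fin L) (b : Bool)
    {φ : (Fin L → Bool) → ℝ} (hφ : DependsOn φ (below L x)) (r r' : Fin L → Bool) :
    resample p q x b φ r r' = φ r' := by
  rw [resample, hφ (update_eq_below r' x true), hφ (update_eq_below r' x false), ← add_mul,
    siteWeight_sum hpq, one_mul]

lemma sum_partialWeight {p q : ℝ} (hpq : p + q = 1) (r : Fin L → Bool) {m : ℕ} (hm : m ≤ L)
    {φ : (Fin L → Bool) → ℝ} (hφ : DependsOn φ (below L m)) :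
    ∑ r', partialWeight p q m r r' * φ r' = ∑ r', Wker p q r r' * φ r' := by
  obtain ⟨d, hd⟩ := Nat.exists_eq_add_of_le hm
  induction d generalizing m with
  | zero =>
    obtain rfl : L = m := hd
    simp only [partialWeight_top hpq]
  | succ d ih =>
    have hmL : m < L := by omega
    rw [← ih hmL (hφ.mono (below_mono (Nat.le_succ m))) (by omega)]
    have := sum_partialWeight_succ p q ⟨m, hmL⟩ r φ
    simp only [resample_of_dependsOn hpq ⟨m, hmL⟩ _ hφ] at this
    exact this.symm

lemma resample_dependsOn (p q : ℝ) (x : Fin L) (b : Bool) {φ : (Fin L → Bool) → ℝ}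
    (hφ : DependsOn φ (below L (x + 1))) (r : Fin L → Bool) :
    DependsOn (resample p q x b φ r) (below L x) := by
  intro r₁ r₂ h
  rw [resample, resample, arrivals_congr x (fun _ _ => rfl) h, hφ (update_agree h true),
    hφ (update_agree h false)]

/-- One may average over the new value of the last relevant site. -/
lemma sum_Wker_resample {p q : ℝ} (hpq : p + q = 1) (x : Fin L) (r : Fin L → Bool)
    {φ : (Fin L → Bool) → ℝ} (hφ : DependsOn φ (below L (x + 1))) :
    ∑ r', Wker p q r r' * φ r' = ∑ r', Wker p q r r' * resample p q x (r x) φ r r' := by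
  rw [← sum_partialWeight hpq r x.2 hφ, sum_partialWeight_succ,
    sum_partialWeight hpq r x.2.le (resample_dependsOn p q x _ hφ r)]

lemma sum_Wker_dependsOn {p q : ℝ} (hpq : p + q = 1) {m : ℕ} (hm : m ≤ L)
    {φ : (Fin L → Bool) → (Fin L → Bool) → ℝ}
    (hφ : ∀ r₁ r₂ r₁' r₂', (∀ y ∈ below L m, r₁ y = r₂ y) → (∀ y ∈ below L m, r₁' y = r₂' y) →
      φ r₁ r₁' = φ r₂ r₂') :
    DependsOn (fun r => ∑ r', Wker p q r r' * φ r r') (below L m) := by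
  intro r₁ r₂ h
  have hd : ∀ r, DependsOn (φ r) (below L m) := fun r _ _ h' => hφ _ _ _ _ (fun _ _ => rfl) h'
  dsimp only
  rw [← sum_partialWeight hpq r₁ hm (hd r₁), ← sum_partialWeight hpq r₂ hm (hd r₂)]
  refine Finset.sum_congr rfl fun r' _ => ?_
  rw [partialWeight_congr p q h fun _ _ => rfl, hφ r₁ r₂ r' r' h fun _ _ => rfl]

lemma psi_eq_prod (p q : ℝ) (r : Fin L → Bool) :
    psi p q r = ∏ y, if r y then p else q := by
  rw [Finset.prod_ite, Finset.prod_const, Finset.prod_const, psi]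
  congr 2
  have := Finset.card_filter_add_card_filter_not (s := Finset.univ) fun y => r y = true
  rw [Finset.card_univ, Fintype.card_fin] at this
  omega

lemma psi_update (p q : ℝ) (r : Fin L → Bool) (x : Fin L) (b : Bool) :
    psi p q (Function.update r x b) =
      (if b then p else q) * ∏ y ∈ Finset.univ.erase x, if r y then p else q := by
  rw [psi_eq_prod, ← Finset.mul_prod_erase _ _ (Finset.mem_univ x), Function.update_self]
  congr 1
  refine Finset.prod_congr rfl fun y hy => ?_
  rw [Function.update_of_ne (Finset.ne_of_mem_erase hy)]

lemma sum_psi_resample {p q : ℝ} (hpq : p + q = 1) (x : Fin L) (f : (Fin L → Bool) → ℝ) :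
    ∑ r, psi p q r * f r = ∑ r, psi p q r *
      (p * f (Function.update r x true) + q * f (Function.update r x false)) := by
  refine mul_left_cancel₀ (two_ne_zero (α := ℝ)) ?_
  rw [← sum_update_bool x, ← sum_update_bool x]
  refine Finset.sum_congr rfl fun r _ => ?_
  simp only [psi_update, Function.update_idem, if_true, Bool.false_eq_true, if_false]
  rw [← add_mul, ← add_mul, hpq]
  ring

/-- One may average over both the old and the new value of the last relevant site. -/
lemma sum_psi_Wker_resample {p q : ℝ} (hpq : p + q = 1) (x : Fin L)
    {φ : (Fin L → Bool) → (Fin L → Bool) → ℝ}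
    (hφ : ∀ r, DependsOn (φ r) (below L (x + 1))) :
    ∑ r, psi p q r * ∑ r', Wker p q r r' * φ r r' =
      ∑ r, psi p q r * ∑ r', Wker p q r r' *
        (p * resample p q x true (φ (Function.update r x true)) r r' +
          q * resample p q x false (φ (Function.update r x false)) r r') := by
  have key : ∀ (r : Fin L → Bool) (b : Bool),
      ∑ r', Wker p q (Function.update r x b) r' * φ (Function.update r x b) r' =
        ∑ r', Wker p q r r' * resample p q x b (φ (Function.update r x b)) r r' := by
    intro r b
    rw [sum_Wker_resample hpq x _ (hφ _), Function.update_self,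
      ← sum_partialWeight hpq _ x.2.le (resample_dependsOn p q x _ (hφ _) _),
      ← sum_partialWeight hpq _ x.2.le (resample_dependsOn p q x _ (hφ _) _)]
    refine Finset.sum_congr rfl fun r' _ => ?_
    rw [partialWeight_congr p q (update_eq_below r x b) fun _ _ => rfl, resample, resample,
      arrivals_congr x (update_eq_below r x b) fun _ _ => rfl]
  rw [sum_psi_resample hpq x]
  refine Finset.sum_congr rfl fun r _ => ?_
  rw [key, key]
  simp only [mul_add, Finset.mul_sum, ← Finset.sum_add_distrib]
  refine Finset.sum_congr rfl fun r' _ => ?_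
  ring

lemma sum_Wker {p q : ℝ} (hpq : p + q = 1) (r : Fin L → Bool) : ∑ r', Wker p q r r' = 1 := by
  have := sum_partialWeight hpq r (Nat.zero_le L) (φ := fun _ => 1) fun _ _ _ => rfl
  simp only [mul_one] at this
  rw [← this]
  simp [partialWeight]

lemma sum_psi_Wker_of_dependsOn {p q : ℝ} (hpq : p + q = 1) (m : ℕ) (hm : m ≤ L)
    {φ : (Fin L → Bool) → ℝ} (hφ : DependsOn φ (below L m)) :
    ∑ r, psi p q r * ∑ r', Wker p q r r' * φ r' = ∑ r, psi p q r * φ r := by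
  induction m generalizing φ with
  | zero =>
    have hc : ∀ r r', φ r' = φ r := fun r r' => hφ fun y hy => absurd hy (Nat.not_lt_zero _)
    refine Finset.sum_congr rfl fun r _ => ?_
    rw [Finset.sum_congr rfl fun r' _ => by rw [hc r r'], ← Finset.sum_mul, sum_Wker hpq, one_mul]
  | succ m ih =>
    let x : Fin L := ⟨m, hm⟩
    rw [sum_psi_Wker_resample hpq x fun _ => hφ, sum_psi_resample hpq x φ,
      ← ih (by omega) (φ := fun r => p * φ (Function.update r x true) +
        q * φ (Function.update r x false))]
    · refine Finset.sum_congr rfl fun r _ => ?_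
      congr 1
      refine Finset.sum_congr rfl fun r' _ => ?_
      congr 1
      by_cases ha : arrivals r r' x = 0
      · simp only [resample_of_eq_zero _ _ _ _ ha]
      · simp only [resample_of_ne_zero _ _ _ _ ha, ← add_mul, hpq, one_mul]
    · intro r₁ r₂ h
      dsimp only
      rw [hφ (update_agree (x := x) h true), hφ (update_agree (x := x) h false)]

lemma psi_stationary {p q : ℝ} (hpq : p + q = 1) (r' : Fin L → Bool) :
    ∑ r, psi p q r * Wker p q r r' = psi p q r' := by
  have := sum_psi_Wker_of_dependsOn hpq L le_rfl (φ := fun r => if r = r' then 1 else 0)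
    fun r₁ r₂ h => by rw [show r₁ = r₂ from funext fun y => h y y.2]
  simpa using this

lemma psi_stationary_pow {p q : ℝ} (hpq : p + q = 1) (n : ℕ) (r' : Fin L → Bool) :
    ∑ r, psi p q r * (Wmat p q L ^ n) r r' = psi p q r' := by
  induction n generalizing r' with
  | zero => simp [Matrix.one_apply]
  | succ n ih =>
    simp only [pow_succ, Matrix.mul_apply, Finset.mul_sum]
    rw [Finset.sum_comm, ← psi_stationary hpq r']
    refine Finset.sum_congr rfl fun r _ => ?_
    rw [← ih r, Finset.sum_mul]
    refine Finset.sum_congr rfl fun r₀ _ => ?_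
    simp only [Wmat, Matrix.of_apply]
    ring

/-- The occupation number of a site, as a real number. -/
def occ (b : Bool) : ℝ := if b then 1 else 0

lemma Wker_mul_flux {p q : ℝ} (hpq : p + q = 1) (r r' : Fin L → Bool) (x : Fin L) :
    Wker p q r r' * (flux r r' x : ℝ) =
      Wker p q r r' * (arrivals r r' x + occ (r x) - occ (r' x)) := by
  by_cases h : arrivals r r' x = 0 ∧ r x = false ∧ r' x = true
  · rw [Wker_eq hpq, weight_eq_mul p q _ _ x]
    have h1 : inflow (addGrain r) r' x = 0 := h.1
    have h2 : (addGrain r).z x = false := h.2.1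
    simp [siteWeight, h1, h2, h.2.2]
  · congr 1
    have h1 : flux r r' x = arrivals r r' x + (r x).toNat - (r' x).toNat :=
      outflow_succ (addGrain r) r' x
    have h2 : (r' x).toNat ≤ arrivals r r' x + (r x).toNat := by
      cases hr : r x <;> cases hr' : r' x <;> simp_all <;> omega
    have h3 : ∀ b : Bool, (b.toNat : ℝ) = occ b := by intro b; cases b <;> simp [occ]
    rw [h1, Nat.cast_sub h2, Nat.cast_add, h3, h3]

lemma arrivals_eq_flux (r r' : Fin L → Bool) {x j : Fin L} (hj : (j : ℕ) + 1 = x) :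
    arrivals r r' x = flux r r' j := by
  have : (addGrain r).w.count x = 0 := by
    unfold addGrain
    split_ifs with h
    · exact Multiset.count_eq_zero.mpr fun hx => by
        have := congrArg Fin.val (Multiset.mem_singleton.mp hx)
        simp at this
        omega
    · simp
  simp [arrivals, inflow, flux, this, hj]

lemma W0ker_eq {p q : ℝ} (hpq : p + q = 1) (j : Fin L) (r r' : Fin L → Bool) :
    W0ker p q j r r' = Wker p q r r' * if flux r r' j = 0 then 1 else 0 := by
  rw [W0ker, tsum_eq_single (flux r r') fun k hk => by simp [Kker_eq hpq, hk]]
  simp [Kker_eq hpq]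

/-- Expected number of topplings at `y` in the next avalanche. -/
noncomputable def meanFlux (p q : ℝ) (y : Fin L) (r : Fin L → Bool) : ℝ :=
  ∑ r', Wker p q r r' * (flux r r' y : ℝ)

/-- Probability that some toppling occurs at `y` in the next avalanche. -/
noncomputable def hitProb (p q : ℝ) (y : Fin L) (r : Fin L → Bool) : ℝ :=
  ∑ r', Wker p q r r' * if 1 ≤ flux r r' y then 1 else 0

/-- Summing out all variables of a two-avalanche correlation but those of the first one. -/
lemma sum_two_avalanches {p q : ℝ} (hpq : p + q = 1) (n : ℕ) {m : ℕ}
    (M : Matrix (Fin L → Bool) (Fin L → Bool) ℝ) (f g : (Fin L → ℕ) → ℝ) :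
    (∑ r0 : Fin L → Bool, ∑ r1 : Fin L → Bool, ∑ r2 : Fin L → Bool,
      ∑ r3 : Fin L → Bool, ∑ r4 : Fin L → Bool,
        psi p q r0 * (Wmat p q L ^ n) r0 r1 * (Wker p q r1 r2 * f (flux r1 r2)) *
          (M ^ m) r2 r3 * (Wker p q r3 r4 * g (flux r3 r4))) =
      ∑ r, psi p q r * ∑ r', Wker p q r r' *
        (f (flux r r') * (M ^ m).mulVec (fun r3 => ∑ r4, Wker p q r3 r4 * g (flux r3 r4)) r') := by
  rw [Finset.sum_comm]
  refine Finset.sum_congr rfl fun r1 _ => ?_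
  rw [← psi_stationary_pow hpq n r1, Finset.sum_mul]
  refine Finset.sum_congr rfl fun r0 _ => ?_
  simp only [Matrix.mulVec, dotProduct, Finset.mul_sum]
  refine Finset.sum_congr rfl fun r2 _ => Finset.sum_congr rfl fun r3 _ =>
    Finset.sum_congr rfl fun r4 _ => ?_
  ring

lemma corrS_eq {p q : ℝ} (hpq : p + q = 1) (t τ : ℕ) (y : Fin L) :
    corrS p q L t τ y y = ∑ r, psi p q r * ∑ r', Wker p q r r' *
      ((flux r r' y : ℝ) * (Wmat p q L ^ (τ - 1)).mulVec (meanFlux p q y) r') := by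
  unfold meanFlux
  rw [← sum_two_avalanches hpq (t - 1) (Wmat p q L) (fun k => (k y : ℝ)) fun k => (k y : ℝ), corrS]
  refine Finset.sum_congr rfl fun r0 _ => Finset.sum_congr rfl fun r1 _ =>
    Finset.sum_congr rfl fun r2 _ => Finset.sum_congr rfl fun r3 _ =>
    Finset.sum_congr rfl fun r4 _ => ?_
  rw [tsum_eq_single (flux r1 r2) fun k hk => by simp [Kker_eq hpq, hk],
    tsum_eq_single (flux r3 r4) fun k hk => by simp [Kker_eq hpq, hk]]
  simp only [Kker_eq hpq, if_true]
  ring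

lemma avalGapProb_eq {p q : ℝ} (hpq : p + q = 1) (t τ : ℕ) (y : Fin L) :
    avalGapProb p q L t τ y = ∑ r, psi p q r * ∑ r', Wker p q r r' *
      ((if 1 ≤ flux r r' y then 1 else 0) *
        (W0mat p q L y ^ (τ - 1)).mulVec (hitProb p q y) r') := by
  unfold hitProb
  rw [← sum_two_avalanches hpq (t - 1) (W0mat p q L y) (fun k => if 1 ≤ k y then 1 else 0)
    fun k => if 1 ≤ k y then 1 else 0, avalGapProb]
  refine Finset.sum_congr rfl fun r0 _ => Finset.sum_congr rfl fun r1 _ =>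
    Finset.sum_congr rfl fun r2 _ => Finset.sum_congr rfl fun r3 _ =>
    Finset.sum_congr rfl fun r4 _ => ?_
  rw [tsum_eq_single (flux r1 r2) fun k hk => by simp [Kker_eq hpq, hk],
    tsum_eq_single (flux r3 r4) fun k hk => by simp [Kker_eq hpq, hk]]
  simp only [Kker_eq hpq, if_true, mul_ite, mul_one, mul_zero]

lemma dependsOn_mulVec_pow {S : Set (Fin L)} {M : Matrix (Fin L → Bool) (Fin L → Bool) ℝ}
    (hM : ∀ g : (Fin L → Bool) → ℝ, DependsOn g S → DependsOn (M.mulVec g) S) (n : ℕ)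
    {g : (Fin L → Bool) → ℝ} (hg : DependsOn g S) : DependsOn ((M ^ n).mulVec g) S := by
  induction n with
  | zero => simpa using hg
  | succ n ih =>
    rw [pow_succ', ← Matrix.mulVec_mulVec]
    exact hM _ ih

lemma flux_congr {r₁ r₂ r₁' r₂' : Fin L → Bool} {x j : Fin L} (hj : (j : ℕ) + 1 = x)
    (h : ∀ y ∈ below L x, r₁ y = r₂ y) (h' : ∀ y ∈ below L x, r₁' y = r₂' y) :
    flux r₁ r₁' j = flux r₂ r₂' j := by
  rw [← arrivals_eq_flux _ _ hj, ← arrivals_eq_flux _ _ hj, arrivals_congr x h h']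

section Recursion

variable {p q : ℝ} {x j : Fin L}

lemma dependsOn_Wmat_mulVec (hpq : p + q = 1) {g : (Fin L → Bool) → ℝ}
    (hg : DependsOn g (below L x)) : DependsOn ((Wmat p q L).mulVec g) (below L x) :=
  sum_Wker_dependsOn hpq x.2.le (φ := fun _ r' => g r') fun _ _ _ _ _ h => hg h

lemma dependsOn_W0mat_mulVec (hpq : p + q = 1) (hj : (j : ℕ) + 1 = x) {g : (Fin L → Bool) → ℝ}
    (hg : DependsOn g (below L x)) : DependsOn ((W0mat p q L j).mulVec g) (below L x) := by
  have := sum_Wker_dependsOn hpq x.2.le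
    (φ := fun r r' => (if flux r r' j = 0 then 1 else 0) * g r') fun _ _ _ _ h h' => by
      rw [flux_congr hj h h', hg h']
  convert this using 1
  funext r
  simp only [Matrix.mulVec, dotProduct, W0mat, Matrix.of_apply, W0ker_eq hpq, mul_assoc]

lemma dependsOn_meanFlux (hpq : p + q = 1) (hj : (j : ℕ) + 1 = x) :
    DependsOn (meanFlux p q j) (below L x) :=
  sum_Wker_dependsOn hpq x.2.le (φ := fun r r' => (flux r r' j : ℝ)) fun _ _ _ _ h h' => by
    rw [flux_congr hj h h']

lemma dependsOn_hitProb (hpq : p + q = 1) (hj : (j : ℕ) + 1 = x) :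
    DependsOn (hitProb p q j) (below L x) :=
  sum_Wker_dependsOn hpq x.2.le (φ := fun r r' => if 1 ≤ flux r r' j then 1 else 0)
    fun _ _ _ _ h h' => by rw [flux_congr hj h h']

lemma eq_of_update_of_dependsOn {g : (Fin L → Bool) → ℝ} (hg : DependsOn g (below L x))
    (r : Fin L → Bool) (b : Bool) : g (Function.update r x b) = g r :=
  hg (update_eq_below r x b)

lemma flux_update (hj : (j : ℕ) + 1 = x) (r r' : Fin L → Bool) (b : Bool) :
    flux r (Function.update r' x b) j = flux r r' j :=
  flux_congr hj (fun _ _ => rfl) (update_eq_below r' x b)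

lemma meanFlux_succ (hpq : p + q = 1) (hj : (j : ℕ) + 1 = x) (r : Fin L → Bool) :
    meanFlux p q x r = meanFlux p q j r + (occ (r x) - p) * hitProb p q j r := by
  simp only [meanFlux, hitProb, Wker_mul_flux hpq _ _ x, arrivals_eq_flux _ _ hj]
  rw [sum_Wker_resample hpq x r (φ := fun r' => (flux r r' j : ℝ) + occ (r x) - occ (r' x)),
    Finset.mul_sum, ← Finset.sum_add_distrib]
  · refine Finset.sum_congr rfl fun r' _ => ?_
    by_cases ha : arrivals r r' x = 0
    · rw [resample_of_eq_zero p q _ _ ha]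
      simp only [flux_update hj]
      rw [arrivals_eq_flux _ _ hj] at ha
      simp [ha]
    · rw [resample_of_ne_zero p q _ _ ha]
      simp only [flux_update hj]
      rw [arrivals_eq_flux _ _ hj] at ha
      simp only [Function.update_self, occ, if_true, Bool.false_eq_true, if_false,
        Nat.one_le_iff_ne_zero.mpr ha]
      linear_combination Wker p q r r' * (flux r r' j + if r x = true then 1 else 0) * hpq
  · intro r₁ r₂ h
    dsimp only
    rw [h x (Nat.lt_succ_self _), flux_congr hj (fun _ _ => rfl) fun y hy => h y (below_mono (by omega) hy)]

lemma Wmat_mulVec_fluctuation (hpq : p + q = 1) (hj : (j : ℕ) + 1 = x) {g : (Fin L → Bool) → ℝ}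
    (hg : DependsOn g (below L x)) (r : Fin L → Bool) :
    (Wmat p q L).mulVec (fun r => (occ (r x) - p) * g r) r =
      (occ (r x) - p) * (W0mat p q L j).mulVec g r := by
  simp only [Matrix.mulVec, dotProduct, Wmat, W0mat, Matrix.of_apply, W0ker_eq hpq]
  rw [sum_Wker_resample hpq x r (φ := fun r' => (occ (r' x) - p) * g r'), Finset.mul_sum]
  · refine Finset.sum_congr rfl fun r' _ => ?_
    by_cases ha : arrivals r r' x = 0
    · rw [resample_of_eq_zero p q _ _ ha]
      rw [arrivals_eq_flux _ _ hj] at ha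
      simp only [Function.update_self, eq_of_update_of_dependsOn hg, ha, if_true]
      ring
    · rw [resample_of_ne_zero p q _ _ ha]
      rw [arrivals_eq_flux _ _ hj] at ha
      simp only [Function.update_self, eq_of_update_of_dependsOn hg, ha, occ, if_true,
        Bool.false_eq_true, if_false]
      linear_combination (-p * g r' * Wker p q r r') * hpq
  · intro r₁ r₂ h
    dsimp only
    rw [h x (Nat.lt_succ_self _), hg fun y hy => h y (below_mono (by omega) hy)]

lemma Wmat_pow_mulVec_fluctuation (hpq : p + q = 1) (hj : (j : ℕ) + 1 = x)
    {g : (Fin L → Bool) → ℝ} (hg : DependsOn g (below L x)) (n : ℕ) :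
    (Wmat p q L ^ n).mulVec (fun r => (occ (r x) - p) * g r) =
      fun r => (occ (r x) - p) * (W0mat p q L j ^ n).mulVec g r := by
  induction n with
  | zero => simp
  | succ n ih =>
    rw [pow_succ', ← Matrix.mulVec_mulVec, ih, pow_succ', ← Matrix.mulVec_mulVec]
    funext r
    exact Wmat_mulVec_fluctuation hpq hj
      (dependsOn_mulVec_pow (fun g hg => dependsOn_W0mat_mulVec hpq hj hg) n hg) r

lemma corrS_succ (hpq : p + q = 1) (hj : (j : ℕ) + 1 = x) (t τ : ℕ) :
    corrS p q L t τ x x = corrS p q L t τ j j - p * q * avalGapProb p q L t τ j := by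
  rw [corrS_eq hpq, corrS_eq hpq, avalGapProb_eq hpq]
  have hG := dependsOn_mulVec_pow (fun g hg => dependsOn_Wmat_mulVec hpq hg) (τ - 1)
    (dependsOn_meanFlux (p := p) (q := q) hpq hj)
  have hV := dependsOn_mulVec_pow (fun g hg => dependsOn_W0mat_mulVec hpq hj hg) (τ - 1)
    (dependsOn_hitProb (p := p) (q := q) hpq hj)
  have hx : meanFlux p q x =
      meanFlux p q j + fun r => (occ (r x) - p) * hitProb p q j r :=
    funext fun r => meanFlux_succ hpq hj r
  rw [hx, Matrix.mulVec_add,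
    Wmat_pow_mulVec_fluctuation hpq hj (dependsOn_hitProb hpq hj)]
  generalize (Wmat p q L ^ (τ - 1)).mulVec (meanFlux p q j) = G at hG ⊢
  generalize (W0mat p q L j ^ (τ - 1)).mulVec (hitProb p q j) = V at hV ⊢
  simp only [← mul_assoc, Wker_mul_flux hpq _ _ x, arrivals_eq_flux _ _ hj]
  simp only [mul_assoc, Pi.add_apply]
  rw [sum_psi_Wker_resample hpq x (φ := fun r r' =>
    ((flux r r' j : ℝ) + occ (r x) - occ (r' x)) * (G r' + (occ (r' x) - p) * V r'))]
  · simp only [Finset.mul_sum, ← Finset.sum_sub_distrib]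
    refine Finset.sum_congr rfl fun r _ => Finset.sum_congr rfl fun r' _ => ?_
    have hf : ∀ b b', flux (Function.update r x b) (Function.update r' x b') j = flux r r' j :=
      fun b b' => flux_congr hj (update_eq_below r x b) (update_eq_below r' x b')
    by_cases ha : arrivals r r' x = 0
    · rw [resample_of_eq_zero p q _ _ ha, resample_of_eq_zero p q _ _ ha]
      rw [arrivals_eq_flux _ _ hj] at ha
      simp [hf, ha]
    · rw [resample_of_ne_zero p q _ _ ha, resample_of_ne_zero p q _ _ ha]
      rw [arrivals_eq_flux _ _ hj] at ha
      simp only [hf, Function.update_self, eq_of_update_of_dependsOn hG, eq_of_update_of_dependsOn hV,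
        occ, if_true, Bool.false_eq_true, if_false, Nat.one_le_iff_ne_zero.mpr ha]
      obtain rfl : q = 1 - p := by linarith
      ring
  · intro r r₁ r₂ h
    have h' : ∀ y ∈ below L x, r₁ y = r₂ y := fun y hy => h y (below_mono (by omega) hy)
    dsimp only
    rw [h x (Nat.lt_succ_self _), flux_congr hj (fun _ _ => rfl) h', hG h', hV h']

end Recursion

lemma siteWeight_nonneg {p q : ℝ} (hp : 0 ≤ p) (hq : 0 ≤ q) (a : ℕ) (b c : Bool) :
    0 ≤ siteWeight p q a b c := by
  unfold siteWeight
  split_ifs <;> first | exact zero_le_one | exact le_rfl | assumption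

lemma Wker_nonneg {p q : ℝ} (hp : 0 ≤ p) (hq : 0 ≤ q) (hpq : p + q = 1) (r r' : Fin L → Bool) :
    0 ≤ Wker p q r r' := by
  rw [Wker_eq hpq]
  exact Finset.prod_nonneg fun y _ => siteWeight_nonneg hp hq _ _ _

lemma mulVec_pow_nonneg {ι : Type*} [Fintype ι] [DecidableEq ι] {M : Matrix ι ι ℝ}
    (hM : ∀ i k, 0 ≤ M i k) {v : ι → ℝ} (hv : ∀ i, 0 ≤ v i) (n : ℕ) (i : ι) :
    0 ≤ (M ^ n).mulVec v i := by
  induction n generalizing i with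
  | zero => simpa using hv i
  | succ n ih =>
    rw [pow_succ', ← Matrix.mulVec_mulVec]
    exact Finset.sum_nonneg fun k _ => mul_nonneg (hM i k) (ih k)

lemma avalGapProb_nonneg {p q : ℝ} (hp : 0 ≤ p) (hq : 0 ≤ q) (hpq : p + q = 1) (t τ : ℕ)
    (y : Fin L) : 0 ≤ avalGapProb p q L t τ y := by
  have ind : ∀ (P : Prop) [Decidable P], (0 : ℝ) ≤ if P then 1 else 0 := fun P _ => by
    split_ifs <;> norm_num
  rw [avalGapProb_eq hpq]
  refine Finset.sum_nonneg fun r _ => mul_nonneg (by unfold psi; positivity) <|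
    Finset.sum_nonneg fun r' _ => mul_nonneg (Wker_nonneg hp hq hpq _ _) <|
    mul_nonneg (ind _) <| mulVec_pow_nonneg (fun r r' => ?_) (fun r => ?_) _ _
  · rw [W0mat, Matrix.of_apply, W0ker_eq hpq]
    exact mul_nonneg (Wker_nonneg hp hq hpq _ _) (ind _)
  · exact Finset.sum_nonneg fun r' _ => mul_nonneg (Wker_nonneg hp hq hpq _ _) (ind _)

lemma corrS_succ_le {p q : ℝ} (hp : 0 ≤ p) (hq : 0 ≤ q) (hpq : p + q = 1) {x j : Fin L}
    (hj : (j : ℕ) + 1 = x) (t τ : ℕ) : corrS p q L t τ x x ≤ corrS p q L t τ j j := by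
  rw [corrS_succ hpq hj]
  have := mul_nonneg (mul_nonneg hp hq) (avalGapProb_nonneg hp hq hpq t τ j)
  linarith

lemma corrS_antitone {p q : ℝ} (hp : 0 ≤ p) (hq : 0 ≤ q) (hpq : p + q = 1) (t τ : ℕ) :
    Antitone fun x : Fin L => corrS p q L t τ x x := by
  intro x₁ x₂ h
  obtain ⟨d, hd⟩ := Nat.exists_eq_add_of_le (Fin.le_def.mp h)
  induction d generalizing x₂ with
  | zero => rw [Fin.ext hd]
  | succ d ih =>
    have hlt : (x₁ : ℕ) + d < L := by have := x₂.2; omega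
    exact (corrS_succ_le (j := ⟨x₁ + d, hlt⟩) hp hq hpq (by simp; omega) t τ).trans
      (ih (x₂ := ⟨x₁ + d, hlt⟩) (Fin.le_def.mpr (Nat.le_add_right _ _)) rfl)

/-- recursion for the avalanche two-point function. For a site `x` with left
neighbour `j` (so `j+1 = x` as indices), `t ≥ 1` and `τ ≥ 1`:
`E[s(x,t)s(x,t+τ)] = E[s(j,t)s(j,t+τ)] - pq·P(s(j,t) ≥ 1, s(j,t+k)=0 ∀ 1 ≤ k ≤ τ-1, s(j,t+τ) ≥ 1)`.
In particular `E[s(x,t)s(x,t+τ)] ≤ E[s(j,t)s(j,t+τ)]`, and the two-point function is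
non-increasing in the site. -/
theorem avalanche_correlation_recursion
    (L : ℕ) (hL : 0 < L) (p q : ℝ) (hp : 0 < p) (hq : 0 < q) (hpq : p + q = 1)
    (x j : Fin L) (hj : (j : ℕ) + 1 = (x : ℕ)) (t τ : ℕ) (ht : 1 ≤ t) (hτ : 1 ≤ τ) :
    corrS p q L t τ x x = corrS p q L t τ j j - p * q * avalGapProb p q L t τ j ∧
    corrS p q L t τ x x ≤ corrS p q L t τ j j ∧
    (∀ x₁ x₂ : Fin L, x₁ ≤ x₂ → corrS p q L t τ x₂ x₂ ≤ corrS p q L t τ x₁ x₁) := by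
  exact ⟨corrS_succ hpq hj t τ, corrS_succ_le hp.le hq.le hpq hj t τ,
    fun _ _ h => corrS_antitone hp.le hq.le hpq t τ h⟩

end DSS
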